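/- arXiv:1707.00353 — 2 statements merged into one kernel-verified Lean document; each statement's English description precedes it below -/
import Mathlib

section
/- Let F be a finite field with q elements and f₁,…,f_n ∈ F[X] nonconstant polynomials without constant term. If ⌊(q-1)/deg(f₁)⌋ + … + ⌊(q-1)/deg(f_n)⌋ > q - 1, then the equation f₁(X₁) + … + f_n(X_n) = 0 has a nontrivial solution in Fⁿ (a solution other than (0,…,0)). -/
theorem Polynomial.sum_eval_eq_zero_of_natDegree_lt {K : Type*} [Field K] [Fintype K]
    (p : Polynomial K) (h : p.natDegree < Fintype.card K - 1) : ∑ a : K, p.eval a = 0 := by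
  simp only [Polynomial.eval_eq_sum_range]
  rw [Finset.sum_comm]
  refine Finset.sum_eq_zero fun i hi => ?_
  rw [← Finset.mul_sum, FiniteField.sum_pow_lt_card_sub_one K i, mul_zero]
  have := Finset.mem_range.mp hi
  omega

theorem sum_pow_sum_eval_eq_zero {K : Type*} [Field K] [Fintype K] {ι : Type*} [Fintype ι]
    [DecidableEq ι] (f : ι → Polynomial K) (m : ℕ)
    (h : m < ∑ j, (Fintype.card K - 1) / (f j).natDegree) :
    ∑ x : ι → K, (∑ j, (f j).eval (x j)) ^ m = 0 := by
  simp only [Finset.sum_pow_eq_sum_piAntidiag]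
  rw [Finset.sum_comm]
  refine Finset.sum_eq_zero fun k hk => ?_
  rw [← Finset.mul_sum]
  obtain ⟨j, hj⟩ : ∃ j, k j < (Fintype.card K - 1) / (f j).natDegree := by
    by_contra! hle
    have hsum : ∑ j, k j = m := (Finset.mem_piAntidiag.mp hk).1
    exact (h.trans_le (Finset.sum_le_sum fun j _ => hle j)).ne hsum.symm
  have hdeg : (f j ^ k j).natDegree < Fintype.card K - 1 := by
    have hpos : 0 < (f j).natDegree := by
      by_contra h0
      simp_all
    calc (f j ^ k j).natDegree ≤ k j * (f j).natDegree := Polynomial.natDegree_pow_le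
      _ < (k j + 1) * (f j).natDegree := Nat.mul_lt_mul_of_pos_right (Nat.lt_succ_self _) hpos
      _ ≤ Fintype.card K - 1 := (Nat.mul_le_mul_right _ hj).trans (Nat.div_mul_le_self _ _)
  have hprod := Fintype.prod_sum fun (i : ι) (a : K) => (f i).eval a ^ k i
  rw [← hprod, Finset.prod_eq_zero (Finset.mem_univ j), mul_zero]
  simpa only [Polynomial.eval_pow] using (f j ^ k j).sum_eval_eq_zero_of_natDegree_lt hdeg

/-- Corollary 2 (second part): nontrivial solutions. -/
theorem stmt_5 (F : Type*) [Field F] [Fintype F] (q n : ℕ) (hq : Fintype.card F = q)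
    (f : Fin n → Polynomial F) (hf : ∀ j, 0 < (f j).natDegree) (hf0 : ∀ j, (f j).eval 0 = 0)
    (hdeg : q - 1 < ∑ j, (q - 1) / (f j).natDegree) :
    ∃ x : Fin n → F, x ≠ 0 ∧ ∑ j, (f j).eval (x j) = 0 := by
  classical
  subst hq
  by_contra! hne
  have hcard : (Fintype.card (Fin n → F) : F) = 0 := by
    have hn : n ≠ 0 := by
      rintro rfl
      simp at hdeg
    simp [hn]
  have hq1 : Fintype.card F - 1 ≠ 0 := Nat.sub_ne_zero_of_lt Fintype.one_lt_card
  have hpow (x : Fin n → F) :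
      (∑ j, (f j).eval (x j)) ^ (Fintype.card F - 1) = 1 - if x = 0 then 1 else 0 := by
    split_ifs with hx
    · simp [hx, hf0, hq1]
    · simp [FiniteField.pow_card_sub_one_eq_one _ (hne x hx)]
  have hzero := sum_pow_sum_eval_eq_zero f _ hdeg
  simp only [hpow, Finset.sum_sub_distrib, Finset.sum_const, Finset.card_univ, nsmul_eq_mul,
    mul_one, hcard] at hzero
  simp at hzero
end

section
/- Let F be a finite field with q elements, q odd, a ∈ F a nonzero nonsquare, and m a positive integer. Suppose 2^r exactly divides q²-1 and 2^{r-1} exactly divides m. Then the value set of the Dickson polynomial D_m(X,a) satisfies |{D_m(c,a) : c ∈ F}| = (q-1)/(2·gcd(m,q-1)) + (q+1)/(2·gcd(m,q+1)) + 1. -/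
open Polynomial in
/-- The functional equation of the Dickson polynomials of the first kind. -/
theorem dickson_one_eval_add {R : Type*} [CommRing R] (a x y : R) (h : x * y = a) :
    ∀ n, (dickson 1 a n).eval (x + y) = x ^ n + y ^ n
  | 0 => by simp only [pow_zero, dickson_zero]; norm_num
  | 1 => by simp only [eval_X, dickson_one, pow_one]
  | n + 2 => by
    simp only [eval_sub, eval_mul, dickson_one_eval_add a x y h _, eval_X, dickson_add_two,
      eval_C]
    linear_combination (x ^ n + y ^ n) * h

/-- In an extension of a finite field `F`, the solutions of `x ^ #F = x` lie in `F`. -/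
theorem exists_algebraMap_eq_of_pow_card_eq {F K : Type*} [Field F] [Fintype F] [Field K]
    [Algebra F K] {x : K} (hx : x ^ Fintype.card F = x) : ∃ c : F, algebraMap F K c = x := by
  classical
  have hne : (Polynomial.X ^ Fintype.card F - Polynomial.X : Polynomial K) ≠ 0 :=
    FiniteField.X_pow_card_sub_X_ne_zero K Fintype.one_lt_card
  have hdeg := FiniteField.X_pow_card_sub_X_natDegree_eq K (Fintype.one_lt_card (α := F))
  have hsub : Finset.univ.image (algebraMap F K) ⊆
      (Polynomial.X ^ Fintype.card F - Polynomial.X : Polynomial K).roots.toFinset := by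
    intro y hy
    obtain ⟨c, -, rfl⟩ := Finset.mem_image.1 hy
    rw [Multiset.mem_toFinset, Polynomial.mem_roots hne]
    simp [← map_pow, FiniteField.pow_card]
  have heq := Finset.eq_of_subset_of_card_le hsub (by
    rw [Finset.card_image_of_injective _ (algebraMap F K).injective, Finset.card_univ]
    exact (Multiset.toFinset_card_le _).trans ((Polynomial.card_roots' _).trans hdeg.le))
  have hmem : x ∈ Finset.univ.image (algebraMap F K) := by
    rw [heq, Multiset.mem_toFinset, Polynomial.mem_roots hne]
    simp [hx]
  obtain ⟨c, -, hc⟩ := Finset.mem_image.1 hmem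
  exact ⟨c, hc⟩

/-- The sums `w + w⁻¹` over the `k`-th roots of unity `w`. -/
def rootSums (K : Type*) [Field K] (k : ℕ) : Set K :=
  (fun w : K => w + w⁻¹) '' {w | w ^ k = 1}

theorem add_inv_eq_add_inv {K : Type*} [Field K] {u v : K} (hu : u ≠ 0) (hv : v ≠ 0)
    (h : u + u⁻¹ = v + v⁻¹) : u = v ∨ u * v = 1 := by
  have : (u - v) * (u * v - 1) = 0 := by
    field_simp at h
    linear_combination h
  rcases mul_eq_zero.1 this with h | h
  · exact Or.inl (sub_eq_zero.1 h)
  · exact Or.inr (sub_eq_zero.1 h)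

theorem ncard_rootSums {K : Type*} [Field K] {h : ℕ} {ζ : K}
    (hζ : IsPrimitiveRoot ζ (2 * h + 1)) : (rootSums K (2 * h + 1)).ncard = h + 1 := by
  have hne : ζ ≠ 0 := hζ.ne_zero (by omega)
  have himage : rootSums K (2 * h + 1) =
      ((fun i : ℕ => ζ ^ i + (ζ ^ i)⁻¹) '' (Finset.range (h + 1) : Set ℕ)) := by
    ext t
    constructor
    · rintro ⟨w, hw, rfl⟩
      obtain ⟨i, hi, rfl⟩ := hζ.eq_pow_of_pow_eq_one hw
      by_cases hih : i < h + 1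
      · exact ⟨i, by simpa using hih, rfl⟩
      · refine ⟨2 * h + 1 - i, by simp; omega, ?_⟩
        have : ζ ^ (2 * h + 1 - i) = (ζ ^ i)⁻¹ := by
          apply eq_inv_of_mul_eq_one_left
          rw [← pow_add, Nat.sub_add_cancel hi.le, hζ.pow_eq_one]
        simp only [this, inv_inv]
        ring
    · rintro ⟨i, -, rfl⟩
      refine ⟨ζ ^ i, ?_, rfl⟩
      change (ζ ^ i) ^ (2 * h + 1) = 1
      rw [← pow_mul, mul_comm, pow_mul, hζ.pow_eq_one, one_pow]
  rw [himage, Set.InjOn.ncard_image, Set.ncard_coe_finset, Finset.card_range]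
  intro i hi j hj hij
  simp only [Finset.coe_range, Set.mem_Iio] at hi hj
  rcases add_inv_eq_add_inv (pow_ne_zero i hne) (pow_ne_zero j hne) hij with h1 | h1
  · exact hζ.pow_inj (by omega) (by omega) h1
  · rw [← pow_add] at h1
    have := Nat.eq_zero_of_dvd_of_lt (hζ.dvd_of_pow_eq_one _ h1) (by omega)
    omega

theorem disjoint_neg_rootSums {K : Type*} [Field K] (h2 : (2 : K) ≠ 0) {k l : ℕ} (hk : Odd k)
    (hl : Odd l) : Disjoint (Neg.neg '' rootSums K k) (rootSums K l) := by
  rw [Set.disjoint_left]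
  rintro _ ⟨_, ⟨w, hw, rfl⟩, rfl⟩ ⟨v, hv, hwv⟩
  change w ^ k = 1 at hw
  change v ^ l = 1 at hv
  have hw0 : w ≠ 0 := by rintro rfl; simp [hk.pos.ne'] at hw
  have hv0 : v ≠ 0 := by rintro rfl; simp [hl.pos.ne'] at hv
  have hwl : w ^ l = -1 := by
    rcases add_inv_eq_add_inv hv0 (neg_ne_zero.2 hw0) (by
      simp only [inv_neg]; exact hwv.trans (by ring)) with h | h
    · rw [h, hl.neg_pow] at hv
      rw [← hv, neg_neg]
    · have h' := congrArg (· ^ l) h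
      simp only [mul_pow, hv, one_pow, one_mul, hl.neg_pow] at h'
      rw [← h', neg_neg]
  have h1 : w ^ (k * l) = 1 := by rw [pow_mul, hw, one_pow]
  have h3 : w ^ (k * l) = -1 := by rw [mul_comm, pow_mul, hwl, hk.neg_one_pow]
  apply h2
  linear_combination h1.symm.trans h3

/-- The `M`-th powers of the solutions of `u ^ N = -1`, given one solution `e`. -/
theorem exists_pow_eq_iff {K : Type*} [Field K] [IsAlgClosed K] {M N k : ℕ} (hN : 0 < N)
    (hk : k * Nat.gcd M N = N) {e : K} (he : e ^ N = -1) (w : K) :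
    (∃ u : K, u ^ N = -1 ∧ u ^ M = e ^ M * w) ↔ w ^ k = 1 := by
  have he0 : e ≠ 0 := by rintro rfl; simp [hN.ne'] at he
  have hg : 0 < Nat.gcd M N := Nat.gcd_pos_of_pos_right _ hN
  constructor
  · rintro ⟨u, hu, huM⟩
    have hw : w = (u / e) ^ M := by
      rw [div_pow, huM, mul_div_cancel_left₀ _ (pow_ne_zero _ he0)]
    obtain ⟨M', hM'⟩ := Nat.gcd_dvd_left M N
    have hMk : M * k = N * M' := by
      calc M * k = (Nat.gcd M N * M') * k := by rw [← hM']
        _ = (k * Nat.gcd M N) * M' := by ring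
        _ = N * M' := by rw [hk]
    rw [hw, ← pow_mul, hMk, pow_mul, div_pow, hu, he, div_self (by simp), one_pow]
  · intro hw
    obtain ⟨v, hv⟩ := IsAlgClosed.exists_pow_nat_eq w hg
    have hvN : v ^ N = 1 := by rw [← hk, mul_comm, pow_mul, hv, hw]
    have hv0 : v ≠ 0 := by rintro rfl; simp [hN.ne'] at hvN
    refine ⟨e * v ^ (Nat.gcdA M N), ?_, ?_⟩
    · rw [mul_pow, he, ← zpow_natCast, ← zpow_mul, mul_comm (Nat.gcdA M N), zpow_mul,
        zpow_natCast, hvN, one_zpow, mul_one]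
    · rw [mul_pow, ← hv, ← zpow_natCast v (Nat.gcd M N), Nat.gcd_eq_gcd_ab, zpow_add₀ hv0,
        zpow_mul v (N : ℤ), zpow_natCast v N, hvN, one_zpow, mul_one, mul_comm (M : ℤ), zpow_mul,
        zpow_natCast _ M]

/-- Parametrization of the value set of a Dickson polynomial of even degree with nonsquare
parameter. -/
theorem exists_dickson_eval_eq_iff {F K : Type*} [Field F] [Fintype F] [Field K] [IsAlgClosed K]
    [Algebra F K] {n M : ℕ} (hq : Fintype.card F = 2 * n + 1) (hn : 0 < n) {a : F}
    (han : a ^ n = -1) (x : K) :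
    (∃ c : F, algebraMap F K ((Polynomial.dickson 1 a (2 * M)).eval c) = x) ↔
      ∃ u : K, (u ^ n = -1 ∨ u ^ (n + 1) = -1) ∧
        algebraMap F K a ^ M * (u ^ M + (u ^ M)⁻¹) = x := by
  set α := algebraMap F K a with hα
  have hαn : α ^ n = -1 := by rw [hα, ← map_pow, han]; simp
  have hα0 : α ≠ 0 := by intro h; simp [h, hn.ne'] at hαn
  have hval (c : F) (y : K) (hy : y ≠ 0) (hc : algebraMap F K c = y + α / y) :
      algebraMap F K ((Polynomial.dickson 1 a (2 * M)).eval c) =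
        α ^ M * ((y ^ 2 / α) ^ M + ((y ^ 2 / α) ^ M)⁻¹) := by
    rw [← Polynomial.eval_map_apply, Polynomial.map_dickson, hc,
      dickson_one_eval_add _ _ _ (mul_div_cancel₀ α hy)]
    have := pow_ne_zero M hα0
    have := pow_ne_zero M hy
    rw [div_pow, div_pow, ← pow_mul, pow_mul', pow_mul']
    field_simp
  have hfrob (y : K) : (y + α / y) ^ (2 * n + 1) =
      y ^ (2 * n + 1) + α / y ^ (2 * n + 1) := by
    have h := map_add (FiniteField.frobeniusAlgHom F K) y (α / y)
    simp only [FiniteField.coe_frobeniusAlgHom, hq, div_pow] at h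
    rw [h]
    congr 2
    rw [hα, ← map_pow, ← hq, FiniteField.pow_card]
  constructor
  · rintro ⟨c, rfl⟩
    obtain ⟨y, hy⟩ := IsAlgClosed.exists_eval₂_eq_zero (RingHom.id K)
      (Polynomial.X ^ 2 - Polynomial.C (algebraMap F K c) * Polynomial.X + Polynomial.C α)
      (by
        have : (Polynomial.X ^ 2 - Polynomial.C (algebraMap F K c) * Polynomial.X +
          Polynomial.C α : Polynomial K).degree = 2 := by compute_degree!
        rw [this]; simp)
    simp only [Polynomial.eval₂_id, Polynomial.eval_add, Polynomial.eval_sub, Polynomial.eval_mul,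
      Polynomial.eval_pow, Polynomial.eval_X, Polynomial.eval_C] at hy
    have hy0 : y ≠ 0 := by rintro rfl; simp [hα0] at hy
    have hc : algebraMap F K c = y + α / y := by
      field_simp
      linear_combination -hy
    refine ⟨y ^ 2 / α, ?_, (hval c y hy0 hc).symm⟩
    have hcq : (y + α / y) ^ (2 * n + 1) = y + α / y := by
      rw [← hc, ← map_pow, ← hq, FiniteField.pow_card]
    rw [hfrob] at hcq
    have hyq := pow_ne_zero (2 * n + 1) hy0
    have hprod : (y ^ (2 * n + 1) - y) * (y ^ (2 * n + 1) * y - α) = 0 := by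
      field_simp at hcq
      linear_combination hcq
    rcases mul_eq_zero.1 hprod with h | h
    · left
      have : y ^ (2 * n) = 1 := mul_right_cancel₀ hy0 (by rw [← pow_succ]; linear_combination h)
      rw [div_pow, hαn, ← pow_mul, this]
      norm_num
    · right
      have : y ^ (2 * (n + 1)) = α := by linear_combination h
      rw [div_pow, ← pow_mul, this, pow_succ, hαn]
      field_simp
  · rintro ⟨u, hu, rfl⟩
    obtain ⟨y, hy⟩ := IsAlgClosed.exists_pow_nat_eq (α * u) two_pos
    have hu0 : u ≠ 0 := by rintro rfl; simp [hn.ne'] at hu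
    have hy0 : y ≠ 0 := by rintro rfl; simp [hα0, hu0] at hy
    have hyu : y ^ 2 / α = u := by rw [hy]; field_simp
    have hcq : (y + α / y) ^ Fintype.card F = y + α / y := by
      rw [hq, hfrob]
      rcases hu with hu | hu
      · have : y ^ (2 * n + 1) = y := by
          rw [pow_succ, pow_mul, hy, mul_pow, hu, hαn]; ring
        rw [this]
      · have : y ^ (2 * n + 1) = α / y := by
          rw [eq_div_iff hy0, ← pow_succ, show 2 * n + 1 + 1 = 2 * (n + 1) by ring, pow_mul, hy,
            mul_pow, hu, pow_succ, hαn]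
          ring
        rw [this]
        field_simp
        ring
    obtain ⟨c, hc⟩ := exists_algebraMap_eq_of_pow_card_eq hcq
    exact ⟨c, by rw [hval c y hy0 hc, hyu]⟩

/-- If `P` is odd, `M` is even and `Q`, `M` have the same `2`-adic valuation, the values
`u ^ M + u ^ (-M)` with `u ^ P = -1` or `u ^ Q = -1` are sums `w + w⁻¹` over roots of unity of
order dividing `P / gcd(M, P)` and negatives of such sums for `Q / gcd(M, Q)`. -/
theorem setOf_pow_add_inv_eq {K : Type*} [Field K] [IsAlgClosed K] {M P Q k l : ℕ}
    (hP : Odd P) (hQ : 0 < Q) (hM : Even M) (hk : k * Nat.gcd M P = P) (hl : l * Nat.gcd M Q = Q)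
    (hlodd : Odd l) (hMQ : Odd (M / Nat.gcd M Q)) :
    {x : K | ∃ u : K, (u ^ P = -1 ∨ u ^ Q = -1) ∧ u ^ M + (u ^ M)⁻¹ = x} =
      Neg.neg '' rootSums K l ∪ rootSums K k := by
  obtain ⟨e, he⟩ := IsAlgClosed.exists_pow_nat_eq (-1 : K) (Nat.gcd_pos_of_pos_right M hQ)
  have heQ : e ^ Q = -1 := by rw [← hl, mul_comm, pow_mul, he, hlodd.neg_one_pow]
  have heM : e ^ M = -1 := by
    rw [← Nat.mul_div_cancel' (Nat.gcd_dvd_left M Q), pow_mul, he, hMQ.neg_one_pow]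
  have hiffQ := exists_pow_eq_iff hQ hl heQ
  have hiffP := exists_pow_eq_iff hP.pos hk (hP.neg_one_pow (α := K))
  simp only [heM, hM.neg_one_pow, one_mul, neg_one_mul] at hiffP hiffQ
  ext x
  constructor
  · rintro ⟨u, hu | hu, rfl⟩
    · exact Or.inr ⟨u ^ M, (hiffP _).1 ⟨u, hu, rfl⟩, rfl⟩
    · refine Or.inl ⟨_, ⟨-u ^ M, (hiffQ _).1 ⟨u, hu, (neg_neg _).symm⟩, rfl⟩, ?_⟩
      simp only [inv_neg]
      ring
  · rintro (⟨_, ⟨w, hw, rfl⟩, rfl⟩ | ⟨w, hw, rfl⟩)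
    · obtain ⟨u, hu, huM⟩ := (hiffQ w).2 hw
      refine ⟨u, Or.inr hu, ?_⟩
      rw [huM, inv_neg]
      ring
    · obtain ⟨u, hu, huM⟩ := (hiffP w).2 hw
      exact ⟨u, Or.inl hu, by rw [huM]⟩

theorem ncard_rootSums_of_odd {K : Type*} [Field K] [IsAlgClosed K] {k : ℕ} (hk : Odd k)
    (hk0 : (k : K) ≠ 0) : ((rootSums K k).ncard : ℚ) = (k + 1) / 2 := by
  obtain ⟨h, rfl⟩ := hk
  have : NeZero ((2 * h + 1 : ℕ) : K) := ⟨hk0⟩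
  obtain ⟨ζ, hζ⟩ := HasEnoughRootsOfUnity.exists_primitiveRoot K (2 * h + 1)
  rw [ncard_rootSums hζ]
  push_cast
  ring

theorem finite_rootSums {K : Type*} [Field K] {k : ℕ} (hk : 0 < k) : (rootSums K k).Finite := by
  classical
  refine Set.Finite.image _ ((Polynomial.nthRootsFinset k (1 : K)).finite_toSet.subset ?_)
  intro w hw
  simpa [Polynomial.mem_nthRootsFinset hk] using hw

theorem ncard_setOf_pow_add_inv {K : Type*} [Field K] [IsAlgClosed K] {s M P Q : ℕ}
    (h2 : (2 : K) ≠ 0) (hP0 : (P : K) ≠ 0) (hQ0 : (Q : K) ≠ 0) (hs : 0 < s) (hP : Odd P)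
    (hQ : 2 ^ s ∣ Q ∧ ¬ 2 ^ (s + 1) ∣ Q) (hM : 2 ^ s ∣ M ∧ ¬ 2 ^ (s + 1) ∣ M) :
    ({x : K | ∃ u : K, (u ^ P = -1 ∨ u ^ Q = -1) ∧ u ^ M + (u ^ M)⁻¹ = x}.ncard : ℚ) =
      P / (2 * Nat.gcd M P) + Q / (2 * Nat.gcd M Q) + 1 := by
  have hQpos : 0 < Q := Nat.pos_of_ne_zero (by rintro rfl; simp at hQ0)
  have hodd {x : ℕ} (hx : ¬ 2 ^ (s + 1) ∣ x) {g y : ℕ} (hg : 2 ^ s ∣ g) (hgy : g * y = x) :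
      Odd y := by
    rw [← Nat.not_even_iff_odd, even_iff_two_dvd]
    intro hy
    exact hx (hgy ▸ pow_succ 2 s ▸ mul_dvd_mul hg hy)
  have hsg : 2 ^ s ∣ Nat.gcd M Q := Nat.dvd_gcd hM.1 hQ.1
  obtain ⟨k, hk⟩ := Nat.gcd_dvd_right M P
  obtain ⟨l, hl⟩ := Nat.gcd_dvd_right M Q
  have hlodd : Odd l := hodd hQ.2 hsg hl.symm
  have hkodd : Odd k := by
    rw [hk] at hP
    exact (Nat.odd_mul.1 hP).2
  have hMQ : Odd (M / Nat.gcd M Q) :=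
    hodd hM.2 hsg (Nat.mul_div_cancel' (Nat.gcd_dvd_left M Q))
  have hMeven : Even M := even_iff_two_dvd.2 ((dvd_pow_self 2 hs.ne').trans hM.1)
  have hk0 : (k : K) ≠ 0 := by
    intro h
    apply hP0
    rw [hk, Nat.cast_mul, h, mul_zero]
  have hl0 : (l : K) ≠ 0 := by
    intro h
    apply hQ0
    rw [hl, Nat.cast_mul, h, mul_zero]
  rw [setOf_pow_add_inv_eq hP hQpos hMeven (by rw [mul_comm, ← hk]) (by rw [mul_comm, ← hl])
    hlodd hMQ, Set.ncard_union_eq (disjoint_neg_rootSums h2 hlodd hkodd)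
    ((finite_rootSums hlodd.pos).image _) (finite_rootSums hkodd.pos),
    Set.ncard_image_of_injective _ neg_injective, Nat.cast_add, ncard_rootSums_of_odd hlodd hl0,
    ncard_rootSums_of_odd hkodd hk0]
  have hgP : (Nat.gcd M P : ℚ) ≠ 0 := by
    exact_mod_cast (Nat.gcd_pos_of_pos_right M hP.pos).ne'
  have hgQ : (Nat.gcd M Q : ℚ) ≠ 0 := by
    exact_mod_cast (Nat.gcd_pos_of_pos_right M hQpos).ne'
  have hkQ : (P : ℚ) = Nat.gcd M P * k := by exact_mod_cast hk
  have hlQ : (Q : ℚ) = Nat.gcd M Q * l := by exact_mod_cast hl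
  have e1 : (P : ℚ) / (2 * Nat.gcd M P) = k / 2 := by
    rw [div_eq_div_iff (by positivity) two_ne_zero]
    linear_combination 2 * hkQ
  have e2 : (Q : ℚ) / (2 * Nat.gcd M Q) = l / 2 := by
    rw [div_eq_div_iff (by positivity) two_ne_zero]
    linear_combination 2 * hlQ
  rw [e1, e2]
  ring

/-- Exact powers of two pass to the even one of two consecutive factors. -/
theorem two_pow_exactly_dvd_of_mul {s P Q : ℕ} (hP : Odd P) (h1 : 2 ^ s ∣ P * Q)
    (h2 : ¬ 2 ^ (s + 1) ∣ P * Q) : 2 ^ s ∣ Q ∧ ¬ 2 ^ (s + 1) ∣ Q :=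
  ⟨(Nat.Coprime.pow_left s (Nat.coprime_two_left.2 hP)).dvd_of_dvd_mul_left h1,
    fun h => h2 (h.mul_left P)⟩

/-- Value set of a Dickson polynomial with nonsquare parameter when `2^{r-1} ∥ m`. -/
theorem stmt_10 (F : Type*) [Field F] [Fintype F] [DecidableEq F] (q r m : ℕ)
    (hq : Fintype.card F = q) (hqodd : Odd q) (a : F) (ha : a ≠ 0)
    (hans : ¬ ∃ b : F, a = b ^ 2) (hm : 0 < m)
    (hr : 2 ^ r ∣ q ^ 2 - 1 ∧ ¬ 2 ^ (r + 1) ∣ q ^ 2 - 1)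
    (hrm : 2 ^ (r - 1) ∣ m ∧ ¬ 2 ^ r ∣ m) :
    ((Finset.univ.image fun c : F => (Polynomial.dickson 1 a m).eval c).card : ℚ)
      = (q - 1) / (2 * Nat.gcd m (q - 1)) + (q + 1) / (2 * Nat.gcd m (q + 1)) + 1 := by
  obtain ⟨n, rfl⟩ := hqodd
  have hn : 0 < n := by
    have := Fintype.one_lt_card (α := F)
    omega
  have hchar : ringChar F ≠ 2 := by
    intro h
    have := FiniteField.even_card_of_char_two h
    omega
  have han : a ^ n = -1 := by
    have hdiv : Fintype.card F / 2 = n := by omega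
    rcases FiniteField.pow_dichotomy hchar ha with h | h
    · obtain ⟨b, hb⟩ := (FiniteField.isSquare_iff hchar ha).2 h
      exact absurd ⟨b, by rw [hb, sq]⟩ hans
    · rwa [hdiv] at h
  have hsq : (2 * n + 1) ^ 2 - 1 = 4 * (n * (n + 1)) := by
    rw [Nat.sub_eq_iff_eq_add (Nat.one_le_pow _ _ (by omega))]
    ring
  rw [hsq] at hr
  have h8 : 2 ^ 3 ∣ 4 * (n * (n + 1)) := by
    rw [show 2 ^ 3 = 4 * 2 by rfl]
    exact mul_dvd_mul_left 4 (even_iff_two_dvd.1 (Nat.even_mul_succ_self n))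
  have hr3 : 3 ≤ r := by
    by_contra! h
    exact hr.2 ((pow_dvd_pow 2 (by omega)).trans h8)
  obtain ⟨s, rfl⟩ : ∃ s, r = s + 2 := ⟨r - 2, by omega⟩
  have hs : 0 < s := by omega
  have hpow (t : ℕ) : 2 ^ (t + 2) ∣ 4 * (n * (n + 1)) ↔ 2 ^ t ∣ n * (n + 1) := by
    rw [pow_add, mul_comm, show 2 ^ 2 = 4 by rfl]
    exact Nat.mul_dvd_mul_iff_left (by norm_num)
  rw [hpow, show s + 2 + 1 = (s + 1) + 2 by ring, hpow] at hr
  rw [show s + 2 - 1 = s + 1 by omega] at hrm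
  obtain ⟨M, rfl⟩ : 2 ∣ m := (dvd_pow_self 2 (by omega)).trans hrm.1
  have hpowM (t : ℕ) : 2 ^ (t + 1) ∣ 2 * M ↔ 2 ^ t ∣ M := by
    rw [pow_succ', Nat.mul_dvd_mul_iff_left two_pos]
  rw [hpowM, show s + 2 = (s + 1) + 1 by ring, hpowM] at hrm
  let K := AlgebraicClosure F
  have hα0 : algebraMap F K a ^ M ≠ 0 := pow_ne_zero _ (by simpa using ha)
  have hqK : (2 : K) * n + 1 = 0 := by
    have := congrArg (algebraMap F K) (FiniteField.cast_card_eq_zero F)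
    rw [hq] at this
    simpa [map_ofNat] using this
  have hnK : (n : K) ≠ 0 := by intro h; simp [h] at hqK
  have h2K : (2 : K) ≠ 0 := by intro h; simp [h] at hqK
  have hn1K : ((n + 1 : ℕ) : K) ≠ 0 := by
    intro h
    push_cast at h
    have : (1 : K) = 0 := by linear_combination 2 * h - hqK
    exact one_ne_zero this
  have himage : algebraMap F K '' (Finset.univ.image fun c : F =>
      (Polynomial.dickson 1 a (2 * M)).eval c : Finset F) =
      (fun t => algebraMap F K a ^ M * t) ''
        {x : K | ∃ u : K, (u ^ n = -1 ∨ u ^ (n + 1) = -1) ∧ u ^ M + (u ^ M)⁻¹ = x} := by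
    ext x
    have := exists_dickson_eval_eq_iff (M := M) hq hn han x
    simpa [Set.mem_image] using this
  have hcard := congrArg Set.ncard himage
  rw [Set.ncard_image_of_injective _ (algebraMap F K).injective, Set.ncard_coe_finset,
    Set.ncard_image_of_injective _ (mul_right_injective₀ hα0)] at hcard
  rw [hcard, show 2 * n + 1 - 1 = 2 * n by omega, show 2 * n + 1 + 1 = 2 * (n + 1) by ring,
    Nat.gcd_mul_left, Nat.gcd_mul_left]
  have hfinal : ({x : K | ∃ u : K, (u ^ n = -1 ∨ u ^ (n + 1) = -1) ∧
      u ^ M + (u ^ M)⁻¹ = x}.ncard : ℚ) =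
      n / (2 * Nat.gcd M n) + (n + 1 : ℕ) / (2 * Nat.gcd M (n + 1)) + 1 := by
    rcases Nat.even_or_odd n with he | ho
    · have hQ := two_pow_exactly_dvd_of_mul he.add_one (mul_comm n _ ▸ hr.1) (mul_comm n _ ▸ hr.2)
      have := ncard_setOf_pow_add_inv h2K hn1K hnK hs he.add_one hQ hrm
      simp only [or_comm (a := _ ^ n = (-1 : K))]
      rw [this]
      ring
    · exact ncard_setOf_pow_add_inv h2K hnK hn1K hs ho
        (two_pow_exactly_dvd_of_mul ho hr.1 hr.2) hrm
  rw [hfinal]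
  have e1 : ((2 * n + 1 : ℕ) - 1 : ℚ) / (2 * (2 * Nat.gcd M n : ℕ)) = n / (2 * Nat.gcd M n) := by
    rw [← mul_div_mul_left (n : ℚ) _ (two_ne_zero (α := ℚ))]
    push_cast
    ring
  have e2 : ((2 * n + 1 : ℕ) + 1 : ℚ) / (2 * (2 * Nat.gcd M (n + 1) : ℕ)) =
      (n + 1 : ℕ) / (2 * Nat.gcd M (n + 1)) := by
    rw [← mul_div_mul_left ((n + 1 : ℕ) : ℚ) _ (two_ne_zero (α := ℚ))]
    push_cast
    ring
  rw [e1, e2]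
end
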